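/- Let E ⊂ ℝⁿ ≡ ℝⁿ + i·0 ⊂ ℂⁿ be a compact uniformly polynomial cuspidal (UPC) set, with associated polynomial maps h_x of degree ≤ d and constants M > 0 and positive integer m, such that the sum of norms Σ_{ℓ=0}^{d} ‖h_x^{(ℓ)}(0)‖ is uniformly bounded over x ∈ E. Then E has local HCP of some order q: in fact E has local HCP with exponent μ = 1/(2m) and order q = n + 1. -/

import Mathlib

open Metric Filter Topology

noncomputable section

/-- `u` is plurisubharmonic on `U`: it is upper semicontinuous on `U` and satisfies
the sub-mean value inequality on the boundary circles of all complex discs contained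
in `U`. -/
def PshOn {V : Type*} [NormedAddCommGroup V] [NormedSpace ℂ V]
    (U : Set V) (u : V → ℝ) : Prop :=
  UpperSemicontinuousOn u U ∧
    ∀ a ∈ U, ∀ b : V, ∀ r : ℝ, 0 < r →
      (∀ τ : ℂ, ‖τ‖ ≤ r → a + τ • b ∈ U) →
      u a ≤ (2 * Real.pi)⁻¹ *
        ∫ θ in (0:ℝ)..(2 * Real.pi),
          u (a + ((r : ℂ) * Complex.exp ((θ : ℂ) * Complex.I)) • b)

/-- The local potential `ρ(z) = (1/2) log(1 + ‖z‖²)` of the Fubini–Study form on `ℂⁿ`. -/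
def fsPot {V : Type*} [NormedAddCommGroup V] [NormedSpace ℂ V] (z : V) : ℝ :=
  (1 / 2) * Real.log (1 + ‖z‖ ^ 2)

/-- The Lelong class `ℒ` of plurisubharmonic functions on `ℂⁿ` with logarithmic
growth: `f − (1/2) log(1 + ‖z‖²)` is bounded above. -/
def LelongClass (V : Type*) [NormedAddCommGroup V] [NormedSpace ℂ V] : Set (V → ℝ) :=
  {f | PshOn Set.univ f ∧ ∃ c : ℝ, ∀ z : V, f z ≤ fsPot z + c}

/-- The Siciak–Zaharjuta extremal function
`L_E(z) = sup { f(z) : f ∈ ℒ, f ≤ 0 on E }`. -/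
def siciakExt {V : Type*} [NormedAddCommGroup V] [NormedSpace ℂ V]
    (E : Set V) : V → ℝ := fun z =>
  sSup ((fun f : V → ℝ => f z) '' {f | f ∈ LelongClass V ∧ ∀ x ∈ E, f x ≤ 0})

/-- The extremal function `V_E` of `E ⊆ ℂⁿ ⊆ ℙⁿ` with respect to the Fubini–Study
metric `ω`, read on the affine chart `ℂⁿ` through the standard one-to-one
correspondence `PSH(ℙⁿ, ω) ∋ v ↦ v + fsPot ∈ ℒ`; thus `V_E = L_{E, fsPot} − fsPot`. -/
def VFS {V : Type*} [NormedAddCommGroup V] [NormedSpace ℂ V]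
    (E : Set V) : V → ℝ := fun z =>
  sSup ((fun f : V → ℝ => f z - fsPot z) ''
    {f | f ∈ LelongClass V ∧ ∀ x ∈ E, f x ≤ fsPot x})

/-- `E` is non-pluripolar: equivalently (`V_E^* ≢ +∞`, resp. `L_E^* ≢ +∞`), the
defining family of `V_E` is uniformly bounded from above. -/
def NonPluripolar {V : Type*} [NormedAddCommGroup V] [NormedSpace ℂ V]
    (E : Set V) : Prop :=
  ∃ C : ℝ, ∀ f ∈ LelongClass V, (∀ x ∈ E, f x ≤ 0) → ∀ z : V, f z ≤ fsPot z + C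

/-- The standard embedding `ℝⁿ ≃ ℝⁿ + i·0 ⊆ ℂⁿ`. -/
def embRC {n : ℕ} (x : EuclideanSpace ℝ (Fin n)) : EuclideanSpace ℂ (Fin n) :=
  (WithLp.equiv 2 (Fin n → ℂ)).symm fun i => (x i : ℂ)

/-- A plurisubharmonic function is not touched from above at a point of positivity by the real
part of a holomorphic function minus a positive constant on a circle. The positivity excludes
circles on which the function is not integrable. -/
theorem PshOn.not_le_re_sub {V : Type*} [NormedAddCommGroup V] [NormedSpace ℂ V]
    {f : V → ℝ} (hf : PshOn Set.univ f) {x b : V} (hx : 0 < f x) {ρ : ℝ} (hρ : 0 < ρ)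
    {H : ℂ → ℂ} (hH : Differentiable ℂ H) (hH0 : H 0 = 0) {κ : ℝ} (hκ : 0 < κ)
    (h : ∀ ζ : ℂ, ‖ζ‖ = ρ → f (x + ζ • b) ≤ f x + (H ζ).re - κ) : False := by
  have hsub : f x ≤ Real.circleAverage (fun ζ => f (x + ζ • b)) 0 ρ := by
    have := hf.2 x (Set.mem_univ x) b ρ hρ (fun _ _ => Set.mem_univ _)
    simpa [Real.circleAverage_def, circleMap] using this
  by_cases hint : CircleIntegrable (fun ζ => f (x + ζ • b)) 0 ρ
  · have hHc : CircleIntegrable (fun ζ => (H ζ).re) 0 ρ :=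
      (Complex.continuous_re.comp hH.continuous).continuousOn.circleIntegrable hρ.le
    have hcc : CircleIntegrable (fun _ : ℂ => f x - κ) 0 ρ :=
      continuousOn_const.circleIntegrable hρ.le
    have hle : Real.circleAverage (fun ζ => f (x + ζ • b)) 0 ρ ≤
        Real.circleAverage (fun ζ => (H ζ).re + (f x - κ)) 0 ρ := by
      refine Real.circleAverage_mono hint (hHc.add hcc) fun ζ hζ => ?_
      have := h ζ (by simpa [abs_of_pos hρ] using hζ)
      linarith
    have hre : Real.circleAverage (fun ζ => (H ζ).re) 0 ρ = 0 := by
      have hm := (hH.diffContOnCl (s := ball 0 |ρ|)).circleAverage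
      have := Complex.reCLM.circleAverage_comp_comm
        (hH.continuous.continuousOn.circleIntegrable (c := 0) hρ.le)
      rw [hm, hH0] at this
      simpa [Function.comp_def] using this
    rw [Real.circleAverage_fun_add hHc hcc, hre, Real.circleAverage_const] at hle
    linarith
  · rw [Real.circleAverage.integral_undef hint] at hsub
    linarith

/-- First-order Taylor estimate for an entire vector-valued function. -/
theorem exists_taylor_bound {V : Type*} [NormedAddCommGroup V] [NormedSpace ℂ V]
    [CompleteSpace V] {F : ℂ → V} (hF : Differentiable ℂ F) (ζ₁ : ℂ) :
    ∃ C > 0, ∃ ρ > 0, ∀ ζ : ℂ, ‖ζ‖ < ρ →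
      ‖F (ζ₁ + ζ) - F ζ₁ - ζ • deriv F ζ₁‖ ≤ C * ‖ζ‖ ^ 2 := by
  obtain ⟨p, hp⟩ := hF.analyticAt ζ₁
  have hO := hp.isBigO_sub_partialSum_pow 2
  obtain ⟨C, hC, hb⟩ := hO.exists_pos
  rw [Asymptotics.IsBigOWith, Metric.eventually_nhds_iff] at hb
  obtain ⟨ρ, hρ, hb⟩ := hb
  refine ⟨C, hC, ρ, hρ, fun ζ hζ => ?_⟩
  have := hb (y := ζ) (by simpa using hζ)
  have h0 : p.partialSum 2 ζ = F ζ₁ + ζ • deriv F ζ₁ := by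
    have h1 : p.coeff 1 = deriv F ζ₁ := hp.deriv.symm
    have h2 : p.coeff 0 = F ζ₁ := hp.coeff_zero _
    simp [FormalMultilinearSeries.partialSum, Finset.sum_range_succ, h1, h2]
  rw [h0] at this
  simpa [sub_sub] using this

/-- A plurisubharmonic function composed with a holomorphic curve `F` admits no strictly
superharmonic test function from above, in the penalized form where the point is allowed to
leave the curve. -/
theorem PshOn.not_touched_along_curve {V : Type*} [NormedAddCommGroup V] [InnerProductSpace ℂ V]
    [CompleteSpace V] {f : V → ℝ} (hf : PshOn Set.univ f) {F : ℂ → V} (hF : Differentiable ℂ F)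
    {x : V} (hx : 0 < f x) {ζ₁ : ℂ} {N β η ρ₀ : ℝ} (hN : 0 ≤ N) (hη : 0 < η) (hρ₀ : 0 < ρ₀)
    (h : ∀ ζ : ℂ, ‖ζ‖ < ρ₀ →
      f (x + ζ • deriv F ζ₁) - (β * ζ.im - η * ζ.im ^ 2)
          - N * ‖x + ζ • deriv F ζ₁ - F (ζ₁ + ζ)‖ ^ 2 ≤
        f x - N * ‖x - F ζ₁‖ ^ 2) : False := by
  obtain ⟨C, hC, ρ₁, hρ₁, hT⟩ := exists_taylor_bound hF ζ₁
  set G : ℂ → V := fun ζ => F (ζ₁ + ζ) - F ζ₁ - ζ • deriv F ζ₁ with hG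
  have hGd : Differentiable ℂ G := by
    have : Differentiable ℂ fun ζ => F (ζ₁ + ζ) := hF.comp (by fun_prop)
    fun_prop
  set g := x - F ζ₁ with hg
  set ρ : ℝ := min (min ρ₀ ρ₁ / 2) (min 1 (η / (4 * (N * C ^ 2 + 1)))) with hρdef
  have hD : 0 < N * C ^ 2 + 1 := by positivity
  have hρ : 0 < ρ := by positivity
  have hρ0 : ρ < ρ₀ := by
    have h1 : ρ ≤ min ρ₀ ρ₁ / 2 := min_le_left _ _
    have h2 := min_le_left ρ₀ ρ₁
    linarith
  have hρ1 : ρ < ρ₁ := by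
    have h1 : ρ ≤ min ρ₀ ρ₁ / 2 := min_le_left _ _
    have h2 := min_le_right ρ₀ ρ₁
    linarith
  have hρ2 : ρ ≤ 1 := (min_le_right _ _).trans (min_le_left _ _)
  have hρ3 : ρ * (4 * (N * C ^ 2 + 1)) ≤ η := by
    have : ρ ≤ η / (4 * (N * C ^ 2 + 1)) := (min_le_right _ _).trans (min_le_right _ _)
    rwa [le_div_iff₀ (by positivity)] at this
  refine hf.not_le_re_sub (b := deriv F ζ₁) hx hρ
    (H := fun ζ => β * (-Complex.I * ζ) + (η / 2 : ℝ) * ζ ^ 2 - (2 * N : ℝ) * inner ℂ g (G ζ))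
    (κ := η / 2 * ρ ^ 2 - N * (C * ρ ^ 2) ^ 2) ?_ ?_ ?_ ?_
  · have : Differentiable ℂ fun ζ => inner ℂ g (G ζ) :=
      (innerSL ℂ g).differentiable.comp hGd
    fun_prop
  · simp [hG]
  · have h1 : N * C ^ 2 * ρ ^ 2 ≤ (N * C ^ 2 + 1) * ρ := by
      have : ρ ^ 2 ≤ ρ := by nlinarith
      have hNC : 0 ≤ N * C ^ 2 := by positivity
      nlinarith
    have h2 : N * C ^ 2 * ρ ^ 2 ≤ η / 4 := by linarith
    have h3 : 0 < η / 2 - N * C ^ 2 * ρ ^ 2 := by linarith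
    have := mul_pos h3 (pow_pos hρ 2)
    nlinarith
  · intro ζ hζ
    have h1 := h ζ (by rw [hζ]; exact hρ0)
    have h2 := hT ζ (by rw [hζ]; exact hρ1)
    have h3 : x + ζ • deriv F ζ₁ - F (ζ₁ + ζ) = g - G ζ := by
      simp only [hg, hG]; abel
    have h4 : ‖g - G ζ‖ ^ 2 = ‖g‖ ^ 2 - 2 * (inner ℂ g (G ζ)).re + ‖G ζ‖ ^ 2 := by
      simpa using norm_sub_sq (𝕜 := ℂ) g (G ζ)
    have h5 : ‖G ζ‖ ^ 2 ≤ (C * ρ ^ 2) ^ 2 := by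
      rw [hζ] at h2
      exact pow_le_pow_left₀ (norm_nonneg _) h2 2
    have h6 : N * ‖G ζ‖ ^ 2 ≤ N * (C * ρ ^ 2) ^ 2 := mul_le_mul_of_nonneg_left h5 hN
    have h7 : ζ.re ^ 2 + ζ.im ^ 2 = ρ ^ 2 := by
      rw [← hζ, ← Complex.normSq_eq_norm_sq, Complex.normSq_apply]; ring
    have h8 : (β * (-Complex.I * ζ) + (η / 2 : ℝ) * ζ ^ 2
        - (2 * N : ℝ) * inner ℂ g (G ζ) : ℂ).re
        = β * ζ.im + η / 2 * (ζ.re ^ 2 - ζ.im ^ 2) - 2 * N * (inner ℂ g (G ζ)).re := by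
      simp only [Complex.sub_re, Complex.add_re, Complex.re_ofReal_mul]
      simp [pow_two]
    rw [h8]
    rw [h3, h4] at h1
    have h9 : η / 2 * (ζ.re ^ 2 + ζ.im ^ 2) = η / 2 * ρ ^ 2 := by rw [h7]
    nlinarith

theorem fsPot_le_of_norm_le {V : Type*} [NormedAddCommGroup V] [NormedSpace ℂ V]
    {x : V} {K s : ℝ} (hK : 0 ≤ K) (hs : 0 ≤ s) (hx : ‖x‖ ≤ K * Real.exp s + 1) :
    fsPot x ≤ Real.log (K + 2) + s := by
  have he : 1 ≤ Real.exp s := Real.one_le_exp hs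
  have h1 : 1 + ‖x‖ ^ 2 ≤ ((K + 2) * Real.exp s) ^ 2 := by
    have : ‖x‖ ^ 2 ≤ (K * Real.exp s + 1) ^ 2 := pow_le_pow_left₀ (norm_nonneg _) hx 2
    have h2 : 0 ≤ K * Real.exp s := by positivity
    nlinarith
  have h2 : Real.log (1 + ‖x‖ ^ 2) ≤ 2 * (Real.log (K + 2) + s) := by
    calc Real.log (1 + ‖x‖ ^ 2) ≤ Real.log (((K + 2) * Real.exp s) ^ 2) :=
          Real.log_le_log (by positivity) h1
      _ = 2 * (Real.log (K + 2) + s) := by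
          rw [Real.log_pow, Real.log_mul (by positivity) (Real.exp_pos s).ne', Real.log_exp]
          norm_num
  unfold fsPot
  linarith

/-- Phragmén–Lindelöf principle along a periodic entire curve: if `f` is in the Lelong class,
nonpositive on the image of the real axis, and the curve grows at most like `exp (D * Im ζ)` in
the upper half-plane, then `f (F ζ) ≤ D * Im ζ` there. -/
theorem le_mul_im_of_mem_lelongClass {V : Type*} [NormedAddCommGroup V] [InnerProductSpace ℂ V]
    [ProperSpace V] {f : V → ℝ} (hf : f ∈ LelongClass V) {F : ℂ → V} (hF : Differentiable ℂ F)
    (hper : ∀ ζ, F (ζ + (2 * Real.pi : ℝ)) = F ζ) (hreal : ∀ x : ℝ, f (F x) ≤ 0)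
    {D K : ℝ} (hD : 0 ≤ D) (hgrow : ∀ ζ : ℂ, 0 ≤ ζ.im → ‖F ζ‖ ≤ K * Real.exp (D * ζ.im))
    {ζ₀ : ℂ} (hζ₀ : 0 ≤ ζ₀.im) : f (F ζ₀) ≤ D * ζ₀.im := by
  obtain ⟨hpsh, c, hc⟩ := hf
  have husc : UpperSemicontinuous f := upperSemicontinuousOn_univ_iff.1 hpsh.1
  refine le_of_forall_pos_le_add fun ε' hε' => ?_
  by_contra! hlt
  obtain ⟨ε, hε, hεlt⟩ : ∃ ε > 0, (D + ε) * ζ₀.im < f (F ζ₀) := by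
    refine ⟨ε' / (ζ₀.im + 1), by positivity, lt_of_le_of_lt ?_ hlt⟩
    have : ε' / (ζ₀.im + 1) * ζ₀.im ≤ ε' := by
      rw [div_mul_eq_mul_div, div_le_iff₀ (by positivity)]
      nlinarith
    linarith [add_mul D (ε' / (ζ₀.im + 1)) ζ₀.im]
  have hK : 0 ≤ K := by
    have := (norm_nonneg _).trans (hgrow 0 (by simp))
    simpa using this
  set c' := |c + Real.log (K + 2)| with hc'
  have hfle : ∀ ζ : ℂ, 0 ≤ ζ.im → ∀ v : V, ‖v‖ ≤ 1 → f (F ζ + v) ≤ c' + D * ζ.im := by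
    intro ζ hζ v hv
    have h1 := hc (F ζ + v)
    have h2 : fsPot (F ζ + v) ≤ Real.log (K + 2) + D * ζ.im := by
      refine fsPot_le_of_norm_le hK (by positivity) ((norm_add_le _ _).trans ?_)
      linarith [hgrow ζ hζ]
    linarith [le_abs_self (c + Real.log (K + 2))]
  set m₀ := f (F ζ₀) - (D + ε) * ζ₀.im with hm₀
  have hm₀pos : 0 < m₀ := by linarith
  set Y := max (ζ₀.im + 1) (2 * c' / ε + 1) with hY
  have hY1 : ζ₀.im + 1 ≤ Y := le_max_left _ _
  have hY0 : 0 < Y := by linarith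
  have hY2 : c' < ε / 2 * Y := by
    have : 2 * c' / ε + 1 ≤ Y := le_max_right _ _
    have h2 : 2 * c' / ε < Y := by linarith
    rw [div_lt_iff₀ hε] at h2
    linarith
  set η := ε / (2 * Y) with hη
  have hηpos : 0 < η := by positivity
  have hηY : η * Y = ε / 2 := by rw [hη]; field_simp
  have hφ : ∀ y, 0 ≤ y → y ≤ Y → (D + ε / 2) * y ≤ (D + ε) * y - η * y ^ 2 := by
    intro y hy hyY
    have : η * y ≤ ε / 2 := by rw [← hηY]; gcongr
    nlinarith
  obtain ⟨r, hr, hr1, hrU⟩ : ∃ r > 0, r ≤ 1 ∧ ∀ x : ℝ, x ∈ Set.Icc 0 (2 * Real.pi) →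
      ∀ v : V, ‖v‖ ≤ r → f (F x + v) < m₀ := by
    have hcomp : IsCompact ((fun x : ℝ => F x) '' Set.Icc 0 (2 * Real.pi)) :=
      isCompact_Icc.image (hF.continuous.comp Complex.continuous_ofReal)
    obtain ⟨r, hr, hrs⟩ := hcomp.exists_cthickening_subset_open (husc.isOpen_preimage m₀) (by
      rintro _ ⟨x, -, rfl⟩
      exact (hreal x).trans_lt hm₀pos)
    refine ⟨min r 1, by positivity, min_le_right _ _, fun x hx v hv => ?_⟩
    refine hrs (mem_cthickening_of_dist_le _ (F x) _ _ ⟨x, hx, rfl⟩ ?_)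
    simpa using hv.trans (min_le_left _ _)
  set B := c' + D * Y with hB
  have hB0 : 0 ≤ B := by positivity
  set N := (B + 1) / r ^ 2 with hN
  have hN0 : 0 ≤ N := by positivity
  set W : V × ℂ → ℝ := fun p =>
    f (F p.2 + p.1) + -((D + ε) * p.2.im - η * p.2.im ^ 2 + N * ‖p.1‖ ^ 2) with hW
  have hWusc : UpperSemicontinuous W := by
    refine UpperSemicontinuous.add ?_ (Continuous.upperSemicontinuous ?_)
    · exact husc.comp (by have := hF.continuous; fun_prop)
    · have := Complex.continuous_im
      fun_prop
  obtain ⟨⟨v₁, ζ₁⟩, ⟨hv₁, hre₁, him₁⟩, hmax⟩ :=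
    UpperSemicontinuousOn.exists_isMaxOn
      (s := closedBall (0 : V) r ×ˢ (Set.Icc 0 (2 * Real.pi) ×ℂ Set.Icc 0 Y))
      ⟨(0, 0), by simp [hr.le, Complex.mem_reProdIm, Real.pi_pos.le, hY0.le]⟩
      ((isCompact_closedBall _ _).prod (isCompact_Icc.reProdIm isCompact_Icc))
      (hWusc.upperSemicontinuousOn _)
  simp only [Set.mem_preimage] at hre₁ him₁ hv₁
  rw [mem_closedBall_zero_iff] at hv₁
  have hmaxg : ∀ v : V, ‖v‖ ≤ r → ∀ ζ : ℂ, 0 ≤ ζ.im → ζ.im ≤ Y → W (v, ζ) ≤ W (v₁, ζ₁) := by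
    intro v hv ζ h1 h2
    have hp : Function.Periodic (fun x : ℝ => F (x + ζ.im * Complex.I)) (2 * Real.pi) := by
      intro x
      simp only
      rw [← hper (x + ζ.im * Complex.I)]
      congr 1
      push_cast
      ring
    obtain ⟨x, hx, hFx⟩ := hp.exists_mem_Ico₀ Real.two_pi_pos ζ.re
    simp only [Complex.re_add_im] at hFx
    have := hmax (a := (v, x + ζ.im * Complex.I)) (by
      simp [Complex.mem_reProdIm, hv, h1, h2, hx.1, hx.2.le])
    simpa [hW, hFx] using this
  have hWm : m₀ ≤ W (v₁, ζ₁) := by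
    have := hmaxg 0 (by simpa using hr.le) ζ₀ hζ₀ (by linarith)
    simp only [hW, add_zero, norm_zero] at this ⊢
    have h2 : 0 ≤ η * ζ₀.im ^ 2 := by positivity
    nlinarith
  simp only [hW] at hWm
  have hφ₁ := hφ _ him₁.1 him₁.2
  have hφ₁' : 0 ≤ (D + ε / 2) * ζ₁.im := mul_nonneg (by positivity) him₁.1
  have hNv : 0 ≤ N * ‖v₁‖ ^ 2 := by positivity
  have hfpos : 0 < f (F ζ₁ + v₁) := by linarith
  have hfB : f (F ζ₁ + v₁) ≤ c' + D * ζ₁.im := hfle _ him₁.1 _ (hv₁.trans hr1)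
  have hv₁lt : ‖v₁‖ < r := by
    refine lt_of_le_of_ne hv₁ fun heq => ?_
    have h1 : N * ‖v₁‖ ^ 2 = B + 1 := by rw [heq, hN]; field_simp
    have h2 : D * ζ₁.im ≤ D * Y := mul_le_mul_of_nonneg_left him₁.2 hD
    linarith
  have him0 : 0 < ζ₁.im := by
    refine lt_of_le_of_ne him₁.1 fun heq => ?_
    have hζ : ζ₁ = (ζ₁.re : ℂ) := Complex.ext (by simp) (by simp [← heq])
    have := hrU _ hre₁ v₁ hv₁
    rw [← hζ] at this
    linarith
  have himY : ζ₁.im < Y := by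
    refine lt_of_le_of_ne him₁.2 fun heq => ?_
    rw [heq] at hφ₁ hfB hWm
    linarith
  have hev : ∀ᶠ ζ : ℂ in 𝓝 0, ‖F ζ₁ + v₁ + ζ • deriv F ζ₁ - F (ζ₁ + ζ)‖ < r ∧
      0 < (ζ₁ + ζ).im ∧ (ζ₁ + ζ).im < Y := by
    have hFc := hF.continuous
    have himc := Complex.continuous_im
    refine Filter.Eventually.and ?_ (Filter.Eventually.and ?_ ?_)
    · refine ContinuousAt.eventually_lt (by fun_prop) continuousAt_const ?_
      simpa using hv₁lt
    · exact ContinuousAt.eventually_lt continuousAt_const (by fun_prop) (by simpa using him0)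
    · exact ContinuousAt.eventually_lt (by fun_prop) continuousAt_const (by simpa using himY)
  obtain ⟨ρ₀, hρ₀, hball⟩ := Metric.eventually_nhds_iff.1 hev
  refine hpsh.not_touched_along_curve hF (x := F ζ₁ + v₁) hfpos (ζ₁ := ζ₁) (N := N)
    (β := D + ε - 2 * η * ζ₁.im) (η := η) (ρ₀ := ρ₀) hN0 hηpos hρ₀ fun ζ hζ => ?_
  obtain ⟨h1, h2, h3⟩ := hball (y := ζ) (by simpa using hζ)
  have := hmaxg _ h1.le (ζ₁ + ζ) h2.le h3.le
  simp only [hW, add_sub_cancel, Complex.add_im] at this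
  rw [add_sub_cancel_left]
  nlinarith

theorem norm_sin_le_exp_im {ζ : ℂ} (h : 0 ≤ ζ.im) : ‖Complex.sin ζ‖ ≤ Real.exp ζ.im := by
  have h1 : ‖Complex.exp (-ζ * Complex.I)‖ = Real.exp ζ.im := by simp [Complex.norm_exp]
  have h2 : ‖Complex.exp (ζ * Complex.I)‖ ≤ Real.exp ζ.im := by
    simp only [Complex.norm_exp, Complex.mul_I_re, Real.exp_le_exp]
    linarith
  have h3 := norm_sub_le (Complex.exp (-ζ * Complex.I)) (Complex.exp (ζ * Complex.I))
  rw [Complex.sin, norm_div, norm_mul, Complex.norm_I, mul_one, Complex.norm_ofNat]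
  linarith

/-- Bernstein–Walsh type bound at `i` for a Lelong function along a polynomially growing entire
curve that maps `[-T, T]` into the nonpositivity set. -/
theorem le_div_of_mem_lelongClass {V : Type*} [NormedAddCommGroup V] [InnerProductSpace ℂ V]
    [ProperSpace V] {f : V → ℝ} (hf : f ∈ LelongClass V) {P : ℂ → V} (hP : Differentiable ℂ P)
    {T K : ℝ} (hT : 0 < T) (hK : 0 ≤ K) {D : ℕ} (hreal : ∀ t : ℝ, |t| ≤ T → f (P t) ≤ 0)
    (hgrow : ∀ τ : ℂ, ‖P τ‖ ≤ K * (1 + ‖τ‖) ^ D) : f (P Complex.I) ≤ D / T := by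
  have hpos : 0 ≤ Real.arsinh (1 / T) := Real.arsinh_nonneg_iff.2 (by positivity)
  have hmain := le_mul_im_of_mem_lelongClass hf (F := fun ζ => P (T * Complex.sin ζ))
    (D := D) (K := K * (1 + T) ^ D) (ζ₀ := Real.arsinh (1 / T) * Complex.I)
    (hP.comp (by fun_prop)) (fun ζ => by
      have := Complex.sin_periodic ζ
      push_cast
      rw [this]) (fun x => by
      have := hreal (T * Real.sin x) (by
        rw [abs_mul, abs_of_pos hT]
        exact mul_le_of_le_one_right hT.le (Real.abs_sin_le_one x))
      simpa using this) (Nat.cast_nonneg D) (fun ζ hζ => ?_) (by simpa using hpos)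
  · have hsin : (T : ℂ) * Complex.sin (Real.arsinh (1 / T) * Complex.I) = Complex.I := by
      rw [Complex.sin_mul_I, ← Complex.ofReal_sinh, Real.sinh_arsinh]
      push_cast
      have : (T : ℂ) ≠ 0 := by exact_mod_cast hT.ne'
      field_simp
    have hle : Real.arsinh (1 / T) ≤ 1 / T := by
      conv_rhs => rw [← Real.sinh_arsinh (1 / T)]
      exact Real.self_le_sinh_iff.2 hpos
    rw [hsin] at hmain
    refine hmain.trans ?_
    simp only [Complex.mul_im, Complex.ofReal_re, Complex.I_im, mul_one, Complex.ofReal_im,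
      Complex.I_re, mul_zero, add_zero]
    calc (D : ℝ) * Real.arsinh (1 / T) ≤ D * (1 / T) := by gcongr
      _ = D / T := by ring
  · refine (hgrow _).trans ?_
    have he : 1 ≤ Real.exp ζ.im := Real.one_le_exp hζ
    have h1 : 1 + ‖(T : ℂ) * Complex.sin ζ‖ ≤ (1 + T) * Real.exp ζ.im := by
      rw [norm_mul, Complex.norm_real, Real.norm_of_nonneg hT.le]
      nlinarith [norm_sin_le_exp_im hζ]
    calc K * (1 + ‖(T : ℂ) * Complex.sin ζ‖) ^ D ≤ K * ((1 + T) * Real.exp ζ.im) ^ D := by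
          gcongr
      _ = K * (1 + T) ^ D * Real.exp (D * ζ.im) := by
          rw [mul_pow, ← Real.exp_nat_mul]; ring

@[simp] theorem embRC_apply {n : ℕ} (x : EuclideanSpace ℝ (Fin n)) (i : Fin n) :
    embRC x i = (x i : ℂ) := rfl

@[simp] theorem norm_embRC {n : ℕ} (x : EuclideanSpace ℝ (Fin n)) : ‖embRC x‖ = ‖x‖ := by
  simp [EuclideanSpace.norm_eq]

theorem exists_embRC_add_I_smul {n : ℕ} (w : EuclideanSpace ℂ (Fin n)) :
    ∃ v₁ v₂ : EuclideanSpace ℝ (Fin n), w = embRC v₁ + Complex.I • embRC v₂ ∧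
      ‖v₁‖ ≤ ‖w‖ ∧ ‖v₂‖ ≤ ‖w‖ := by
  refine ⟨WithLp.toLp 2 fun i => (w i).re, WithLp.toLp 2 fun i => (w i).im, ?_, ?_, ?_⟩
  · ext i
    simp [mul_comm Complex.I, Complex.re_add_im]
  · simp only [EuclideanSpace.norm_eq]
    gcongr with i
    exact Complex.abs_re_le_norm _
  · simp only [EuclideanSpace.norm_eq]
    gcongr with i
    exact Complex.abs_im_le_norm _

/-- The complexified curve `∑ (lam (1 + τ²))^ℓ c_ℓ` perturbed so that its value at `τ = i` is
displaced by `v₁ + i v₂`, while the displacement stays real for real `τ`. -/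
def cuspCurve {n d : ℕ} (c : Fin (d + 1) → EuclideanSpace ℝ (Fin n))
    (v₁ v₂ : EuclideanSpace ℝ (Fin n)) (k : ℕ) (lam : ℝ) (τ : ℂ) : EuclideanSpace ℂ (Fin n) :=
  ∑ ℓ : Fin (d + 1), ((lam : ℂ) * (1 + τ ^ 2)) ^ (ℓ : ℕ) • embRC (c ℓ) +
    (((-1) ^ (k + 1) * τ ^ (2 * (k + 1))) • embRC v₁ + ((-1) ^ k * τ ^ (2 * k + 1)) • embRC v₂)

section CuspCurve

variable {n d : ℕ} (c : Fin (d + 1) → EuclideanSpace ℝ (Fin n))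
  (v₁ v₂ : EuclideanSpace ℝ (Fin n)) (k : ℕ) (lam : ℝ)

theorem differentiable_cuspCurve : Differentiable ℂ (cuspCurve c v₁ v₂ k lam) := by
  unfold cuspCurve
  fun_prop

theorem cuspCurve_I :
    cuspCurve c v₁ v₂ k lam Complex.I = embRC (c 0) + (embRC v₁ + Complex.I • embRC v₂) := by
  have h1 : ((-1 : ℂ)) ^ (k + 1) * Complex.I ^ (2 * (k + 1)) = 1 := by
    rw [pow_mul, Complex.I_sq, ← mul_pow]; simp
  have h2 : ((-1 : ℂ)) ^ k * Complex.I ^ (2 * k + 1) = Complex.I := by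
    rw [pow_succ, pow_mul, Complex.I_sq, ← mul_assoc, ← mul_pow]; simp
  simp [cuspCurve, h1, h2, Fin.sum_univ_succ]

theorem cuspCurve_ofReal (t : ℝ) :
    cuspCurve c v₁ v₂ k lam t =
      embRC (∑ ℓ : Fin (d + 1), (lam * (1 + t ^ 2)) ^ (ℓ : ℕ) • c ℓ +
        (((-1) ^ (k + 1) * t ^ (2 * (k + 1))) • v₁ + ((-1) ^ k * t ^ (2 * k + 1)) • v₂)) := by
  ext i
  simp [cuspCurve]

theorem norm_cuspCurve_le (hlam : 0 ≤ lam) (hlam1 : lam ≤ 1) (τ : ℂ) :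
    ‖cuspCurve c v₁ v₂ k lam τ‖ ≤
      (∑ ℓ, ‖c ℓ‖ + (‖v₁‖ + ‖v₂‖)) * (1 + ‖τ‖) ^ (2 * d + 2 * (k + 1)) := by
  have hs : 1 ≤ 1 + ‖τ‖ := by linarith [norm_nonneg τ]
  have h1 : ‖(lam : ℂ) * (1 + τ ^ 2)‖ ≤ (1 + ‖τ‖) ^ 2 := by
    have : ‖1 + τ ^ 2‖ ≤ 1 + ‖τ‖ ^ 2 := by
      have := norm_add_le (1 : ℂ) (τ ^ 2)
      rwa [norm_one, norm_pow] at this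
    rw [norm_mul, Complex.norm_real, Real.norm_of_nonneg hlam]
    nlinarith [norm_nonneg τ, norm_nonneg (1 + τ ^ 2)]
  unfold cuspCurve
  rw [add_mul, add_mul, Finset.sum_mul]
  refine (norm_add_le _ _).trans (add_le_add ((norm_sum_le _ _).trans ?_)
    ((norm_add_le _ _).trans (add_le_add ?_ ?_)))
  · refine Finset.sum_le_sum fun ℓ _ => ?_
    rw [norm_smul, norm_pow, norm_embRC, mul_comm]
    gcongr
    calc ‖(lam : ℂ) * (1 + τ ^ 2)‖ ^ (ℓ : ℕ) ≤ ((1 + ‖τ‖) ^ 2) ^ (ℓ : ℕ) := by gcongr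
      _ = (1 + ‖τ‖) ^ (2 * (ℓ : ℕ)) := by rw [pow_mul]
      _ ≤ (1 + ‖τ‖) ^ (2 * d + 2 * (k + 1)) := pow_le_pow_right₀ hs (by omega)
  · rw [norm_smul, norm_embRC, mul_comm]
    gcongr
    calc ‖(-1) ^ (k + 1) * τ ^ (2 * (k + 1))‖ = ‖τ‖ ^ (2 * (k + 1)) := by simp
      _ ≤ (1 + ‖τ‖) ^ (2 * (k + 1)) := by gcongr; linarith
      _ ≤ _ := pow_le_pow_right₀ hs (by omega)
  · rw [norm_smul, norm_embRC, mul_comm]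
    gcongr
    calc ‖(-1) ^ k * τ ^ (2 * k + 1)‖ = ‖τ‖ ^ (2 * k + 1) := by simp
      _ ≤ (1 + ‖τ‖) ^ (2 * k + 1) := by gcongr; linarith
      _ ≤ _ := pow_le_pow_right₀ hs (by omega)

end CuspCurve

theorem norm_sum_pow_smul_sub_le {V : Type*} [NormedAddCommGroup V] [NormedSpace ℝ V] {d : ℕ}
    (c : Fin (d + 1) → V) {s : ℝ} (hs0 : 0 ≤ s) (hs1 : s ≤ 1) :
    ‖∑ ℓ : Fin (d + 1), s ^ (ℓ : ℕ) • c ℓ - c 0‖ ≤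
      s * ∑ ℓ : Fin (d + 1), (Nat.factorial (ℓ : ℕ) : ℝ) * ‖c ℓ‖ := by
  rw [Fin.sum_univ_succ, Fin.sum_univ_succ (n := d), mul_add]
  simp only [Fin.val_zero, pow_zero, one_smul, add_sub_cancel_left]
  have h0 : 0 ≤ s * ((Nat.factorial 0 : ℝ) * ‖c 0‖) := by positivity
  refine le_add_of_nonneg_of_le h0 ((norm_sum_le _ _).trans ?_)
  rw [Finset.mul_sum]
  refine Finset.sum_le_sum fun ℓ _ => ?_
  have h1 : s ^ (ℓ.succ : ℕ) ≤ s := pow_le_of_le_one hs0 hs1 (by simp)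
  have h2 : (1 : ℝ) ≤ (Nat.factorial (ℓ.succ : ℕ) : ℝ) := by
    exact_mod_cast Nat.one_le_iff_ne_zero.2 (Nat.factorial_ne_zero _)
  rw [norm_smul, norm_pow, Real.norm_of_nonneg hs0]
  calc s ^ (ℓ.succ : ℕ) * ‖c ℓ.succ‖ ≤ s * (1 * ‖c ℓ.succ‖) := by rw [one_mul]; gcongr
    _ ≤ _ := by gcongr

theorem cuspCurve_mem {n d k : ℕ} {M A : ℝ} (hM : 0 < M)
    {E : Set (EuclideanSpace ℝ (Fin n))} (c : Fin (d + 1) → EuclideanSpace ℝ (Fin n))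
    (hcusp : ∀ t : ℝ, 0 ≤ t → t ≤ 1 →
      M * t ^ (k + 1) ≤ Metric.infDist (∑ ℓ : Fin (d + 1), t ^ (ℓ : ℕ) • c ℓ) Eᶜ)
    (hbound : ∑ ℓ : Fin (d + 1), (Nat.factorial (ℓ : ℕ) : ℝ) * ‖c ℓ‖ ≤ A)
    {v₁ v₂ : EuclideanSpace ℝ (Fin n)} {r δ lam : ℝ} (hlam : 0 < lam) (hr1 : r ≤ 1)
    (hv₁ : ‖v₁‖ ≤ δ) (hv₂ : ‖v₂‖ ≤ δ) {t : ℝ} (hsr : lam * (1 + t ^ 2) * (A + M + 1) ≤ r)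
    (hdisp : 2 * (δ * (|t| ^ (2 * (k + 1)) + |t| ^ (2 * k + 1))) ≤
      M * (lam * (1 + t ^ 2)) ^ (k + 1)) :
    cuspCurve c v₁ v₂ k lam t ∈ embRC '' E ∩ closedBall (embRC (c 0)) r := by
  have hA : 0 ≤ A := (Finset.sum_nonneg fun _ _ => by positivity).trans hbound
  set s := lam * (1 + t ^ 2) with hs
  have hs0 : 0 < s := by positivity
  have hs1 : s ≤ 1 := by
    have h1 := mul_nonneg hs0.le (add_nonneg hA hM.le)
    have h2 : s * (A + M + 1) = s * (A + M) + s := by ring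
    linarith
  set w := ((-1) ^ (k + 1) * t ^ (2 * (k + 1))) • v₁ + ((-1) ^ k * t ^ (2 * k + 1)) • v₂
    with hw
  have hwle : ‖w‖ ≤ δ * (|t| ^ (2 * (k + 1)) + |t| ^ (2 * k + 1)) := by
    refine (norm_add_le _ _).trans ?_
    simp only [norm_smul, norm_mul, norm_pow, norm_neg, norm_one, one_pow, one_mul,
      Real.norm_eq_abs]
    rw [mul_comm δ, add_mul]
    gcongr
  have hwM : 2 * ‖w‖ ≤ M * s ^ (k + 1) := by linarith
  have hMs : 0 < M * s ^ (k + 1) := by positivity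
  rw [cuspCurve_ofReal, ← hs, ← hw]
  set p := ∑ ℓ : Fin (d + 1), s ^ (ℓ : ℕ) • c ℓ with hp
  refine ⟨⟨p + w, ?_, rfl⟩, ?_⟩
  · by_contra hnot
    have h1 := Metric.infDist_le_dist_of_mem (x := p) (s := Eᶜ) hnot
    rw [dist_self_add_right] at h1
    linarith [hcusp s hs0.le hs1]
  · have h1 : ‖p - c 0‖ ≤ s * A := (norm_sum_pow_smul_sub_le c hs0.le hs1).trans (by gcongr)
    have h2 : s ^ (k + 1) ≤ s := pow_le_of_le_one hs0.le hs1 (by simp)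
    have h3 : embRC (p + w) - embRC (c 0) = embRC (p - c 0 + w) := by
      ext i
      simp
      ring
    rw [mem_closedBall, dist_eq_norm, h3, norm_embRC]
    have h4 := norm_add_le (p - c 0) w
    have h5 : M * s ^ (k + 1) ≤ M * s := by gcongr
    have h6 : s * (A + M + 1) = s * A + M * s + s := by ring
    have h7 := norm_nonneg w
    linarith

/-- The extremal function near a point of a polynomial cusp, estimated along `cuspCurve`; the
parameters `lam` and `T` are free subject to the curve staying in the cusp. -/
theorem siciakExt_le_of_cusp {n d k : ℕ} {M A : ℝ} (hM : 0 < M)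
    {E : Set (EuclideanSpace ℝ (Fin n))} (c : Fin (d + 1) → EuclideanSpace ℝ (Fin n))
    (hcusp : ∀ t : ℝ, 0 ≤ t → t ≤ 1 →
      M * t ^ (k + 1) ≤ Metric.infDist (∑ ℓ : Fin (d + 1), t ^ (ℓ : ℕ) • c ℓ) Eᶜ)
    (hbound : ∑ ℓ : Fin (d + 1), (Nat.factorial (ℓ : ℕ) : ℝ) * ‖c ℓ‖ ≤ A)
    {r δ lam T : ℝ} (hlam : 0 < lam) (hT : 0 < T) (hr : lam * (1 + T ^ 2) * (A + M + 1) ≤ r)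
    (hr1 : r ≤ 1)
    (hdisp : ∀ t : ℝ, |t| ≤ T →
      2 * (δ * (|t| ^ (2 * (k + 1)) + |t| ^ (2 * k + 1))) ≤ M * (lam * (1 + t ^ 2)) ^ (k + 1))
    {z : EuclideanSpace ℂ (Fin n)} (hz : dist z (embRC (c 0)) ≤ δ) :
    siciakExt (embRC '' E ∩ closedBall (embRC (c 0)) r) z ≤ (2 * d + 2 * (k + 1) : ℕ) / T := by
  have hA : 0 ≤ A := (Finset.sum_nonneg fun _ _ => by positivity).trans hbound
  obtain ⟨v₁, v₂, hv, hv₁, hv₂⟩ := exists_embRC_add_I_smul (z - embRC (c 0))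
  rw [← dist_eq_norm] at hv₁ hv₂
  have hmem : ∀ t : ℝ, |t| ≤ T →
      cuspCurve c v₁ v₂ k lam t ∈ embRC '' E ∩ closedBall (embRC (c 0)) r := by
    intro t ht
    have ht2 : t ^ 2 ≤ T ^ 2 := by rw [← sq_abs]; gcongr
    have hsr : lam * (1 + t ^ 2) * (A + M + 1) ≤ r := le_trans (by gcongr) hr
    exact cuspCurve_mem hM c hcusp hbound hlam hr1 (hv₁.trans hz) (hv₂.trans hz) hsr (hdisp t ht)
  have hlam1 : lam ≤ 1 := by
    have h0 : 0 ≤ lam * T ^ 2 := by positivity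
    have h1 : 0 ≤ lam * (1 + T ^ 2) * (A + M) := by positivity
    have h2 : lam * (1 + T ^ 2) * (A + M + 1) =
        lam * (1 + T ^ 2) * (A + M) + lam + lam * T ^ 2 := by ring
    linarith
  have hK : 0 ≤ ∑ ℓ, ‖c ℓ‖ + (‖v₁‖ + ‖v₂‖) := add_nonneg
    (Finset.sum_nonneg fun _ _ => norm_nonneg _) (add_nonneg (norm_nonneg _) (norm_nonneg _))
  have hcurve := cuspCurve_I c v₁ v₂ k lam
  rw [← hv, add_sub_cancel] at hcurve
  have hgrowth := norm_cuspCurve_le c v₁ v₂ k lam hlam.le hlam1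
  have hdiff := differentiable_cuspCurve c v₁ v₂ k lam
  generalize cuspCurve c v₁ v₂ k lam = P at *
  refine Real.sSup_le ?_ (div_nonneg (Nat.cast_nonneg _) hT.le)
  rintro _ ⟨f, ⟨hf, hf0⟩, rfl⟩
  have h := le_div_of_mem_lelongClass hf hdiff hT hK (fun t ht => hf0 _ (hmem t ht)) hgrowth
  rwa [hcurve] at h
/-- Choice of the parameters of `cuspCurve` when `δ` is small compared with `r ^ (k + 1)`. -/
theorem exists_cusp_parameters_of_le {k : ℕ} {M κ r δ σ : ℝ} (hκ : 0 < κ) (hκ1 : κ ≤ 1)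
    (hr : 0 < r) (hr1 : r < 1) (hδ : 0 < δ) (hσ0 : 0 < σ)
    (hσpow : M * (σ ^ 2) ^ (k + 1) = 4 * δ) (hcase : σ ^ 2 ≤ κ * r / 2) :
    ∃ lam T : ℝ, 0 < lam ∧ 0 < T ∧ lam * (1 + T ^ 2) ≤ κ * r ∧
      (∀ t : ℝ, |t| ≤ T → 2 * (δ * (|t| ^ (2 * (k + 1)) + |t| ^ (2 * k + 1))) ≤
        M * (lam * (1 + t ^ 2)) ^ (k + 1)) ∧ 1 / T = 2 * σ / (κ * r) := by
  refine ⟨σ ^ 2, κ * r / (2 * σ), by positivity, by positivity, ?_, fun t _ => ?_, by field_simp⟩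
  · have h1 : σ ^ 2 * (1 + (κ * r / (2 * σ)) ^ 2) = σ ^ 2 + (κ * r) ^ 2 / 4 := by
      field_simp
      ring
    have h2 : κ * r ≤ 1 := mul_le_one₀ hκ1 hr.le hr1.le
    have h3 : 0 < κ * r := by positivity
    rw [h1]
    nlinarith
  · have hq : 0 ≤ t ^ 2 := sq_nonneg t
    have h1 : |t| ^ (2 * (k + 1)) ≤ (1 + t ^ 2) ^ (k + 1) := by
      rw [pow_mul, sq_abs]
      gcongr
      linarith
    have h2 : |t| ^ (2 * k + 1) ≤ (1 + t ^ 2) ^ (k + 1) := by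
      rw [pow_succ, pow_mul, sq_abs, pow_succ (1 + t ^ 2)]
      gcongr
      · linarith
      · nlinarith [sq_abs t, sq_nonneg (|t| - 1)]
    rw [mul_pow, ← mul_assoc M, hσpow]
    nlinarith

/-- Choice of the parameters of `cuspCurve` when `δ` is large compared with `r ^ (k + 1)`. -/
theorem exists_cusp_parameters_of_lt {k : ℕ} {M κ b r δ : ℝ} (hM : 0 < M) (hκ : 0 < κ)
    (hb0 : 0 < b) (hb1 : b ≤ 1) (hbM : 4 * b ≤ M * (κ / 2) ^ (k + 1))
    (hr : 0 < r) (hr1 : r < 1) (hδ1 : δ ≤ 1) :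
    ∃ lam T : ℝ, 0 < lam ∧ 0 < T ∧ lam * (1 + T ^ 2) ≤ κ * r ∧
      (∀ t : ℝ, |t| ≤ T → 2 * (δ * (|t| ^ (2 * (k + 1)) + |t| ^ (2 * k + 1))) ≤
        M * (lam * (1 + t ^ 2)) ^ (k + 1)) ∧ T = b * r := by
  have hbr : b * r ≤ 1 := mul_le_one₀ hb1 hr.le hr1.le
  refine ⟨κ * r / 2, b * r, by positivity, by positivity, ?_, fun t ht => ?_, rfl⟩
  · have h1 : (b * r) ^ 2 ≤ 1 := pow_le_one₀ (by positivity) hbr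
    have h2 : κ * r / 2 * (b * r) ^ 2 ≤ κ * r / 2 * 1 := by gcongr
    linarith
  · have ht0 := abs_nonneg t
    have h1 : |t| ^ (2 * (k + 1)) ≤ |t| ^ (2 * k + 1) :=
      pow_le_pow_of_le_one ht0 (ht.trans hbr) (by omega)
    have h2 : |t| ^ (2 * k + 1) ≤ b * r ^ (k + 1) := by
      calc |t| ^ (2 * k + 1) ≤ (b * r) ^ (2 * k + 1) := by gcongr
        _ = b ^ (2 * k + 1) * r ^ (2 * k + 1) := mul_pow _ _ _
        _ ≤ b * r ^ (k + 1) := by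
          gcongr ?_ * ?_
          · exact pow_le_of_le_one hb0.le hb1 (by omega)
          · exact pow_le_pow_of_le_one hr.le hr1.le (by omega)
    have h3 : δ * (|t| ^ (2 * (k + 1)) + |t| ^ (2 * k + 1)) ≤ 1 * (2 * (b * r ^ (k + 1))) := by
      gcongr
      linarith
    have h4 : M * (κ / 2) ^ (k + 1) * r ^ (k + 1) ≤
        M * (κ * r / 2 * (1 + t ^ 2)) ^ (k + 1) := by
      have h0 : 0 ≤ κ * r / 2 * t ^ 2 := by positivity
      rw [mul_assoc, ← mul_pow]
      exact mul_le_mul_of_nonneg_left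
        (pow_le_pow_left₀ (by positivity) (by linarith) _) hM.le
    have h5 : 4 * b * r ^ (k + 1) ≤ M * (κ / 2) ^ (k + 1) * r ^ (k + 1) := by gcongr
    linarith

/-- **Theorem (UPC sets have local HCP).**
Let `E ⊆ ℝⁿ ≡ ℝⁿ + i·0 ⊆ ℂⁿ` be a compact uniformly polynomial cuspidal (UPC) set:
for each `x ∈ E` there is a polynomial map `h_x(t) = ∑_{ℓ=0}^{d} t^ℓ • c x ℓ` of
degree `≤ d` (so `h_x^{(ℓ)}(0) = ℓ! • c x ℓ`) with `h_x(0) = x`, `h_x([0,1]) ⊆ E`,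
and `dist(h_x(t), ℝⁿ \ E) ≥ M t^m` for all `t ∈ [0,1]`; assume moreover that
`∑_{ℓ=0}^{d} ‖h_x^{(ℓ)}(0)‖ ≤ A` uniformly on `E`.  Then `E` has local HCP of some
order `q`: in fact local HCP with exponent `μ = 1/(2m)` and order `q = n + 1`. -/
theorem UPC_localHCP
    (n d m : ℕ) (hm : 0 < m) (M A : ℝ) (hM : 0 < M)
    (E : Set (EuclideanSpace ℝ (Fin n))) (hE : IsCompact E)
    (c : EuclideanSpace ℝ (Fin n) → Fin (d + 1) → EuclideanSpace ℝ (Fin n))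
    (hc0 : ∀ x ∈ E, c x 0 = x)
    (hmaps : ∀ x ∈ E, ∀ t : ℝ, 0 ≤ t → t ≤ 1 →
      (∑ ℓ : Fin (d + 1), t ^ (ℓ : ℕ) • c x ℓ) ∈ E)
    (hcusp : ∀ x ∈ E, ∀ t : ℝ, 0 ≤ t → t ≤ 1 →
      M * t ^ m ≤ Metric.infDist (∑ ℓ : Fin (d + 1), t ^ (ℓ : ℕ) • c x ℓ) Eᶜ)
    (hbound : ∀ x ∈ E,
      ∑ ℓ : Fin (d + 1), (Nat.factorial (ℓ : ℕ) : ℝ) * ‖c x ℓ‖ ≤ A) :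
    ∃ C : ℝ, 0 < C ∧ ∃ r₀ : ℝ, 0 < r₀ ∧ r₀ ≤ 1 ∧
      ∀ a ∈ embRC '' E, ∀ r : ℝ, 0 < r → r < r₀ → ∀ δ : ℝ, 0 < δ → δ ≤ 1 →
        ∀ z, dist z a ≤ δ →
          siciakExt ((embRC '' E) ∩ closedBall a r) z ≤
            C * δ ^ ((1 : ℝ) / (2 * m)) / r ^ (n + 1) := by
  rcases E.eq_empty_or_nonempty with rfl | ⟨x₀, hx₀⟩
  · exact ⟨1, one_pos, 1, one_pos, le_rfl, by simp⟩
  have hn : 1 ≤ n := by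
    rcases Nat.eq_zero_or_pos n with rfl | hn
    · have hEc : Eᶜ = ∅ := by
        ext y
        simp [Subsingleton.elim y x₀, hx₀]
      have := hcusp x₀ hx₀ 1 zero_le_one le_rfl
      rw [hEc, Metric.infDist_empty] at this
      simp only [one_pow, mul_one] at this
      linarith
    · exact hn
  obtain ⟨k, rfl⟩ : ∃ k, m = k + 1 := ⟨m - 1, by omega⟩
  have hA : 0 ≤ A := (Finset.sum_nonneg fun _ _ => by positivity).trans (hbound x₀ hx₀)
  set κ : ℝ := 1 / (A + M + 1) with hκdef
  have hκ : 0 < κ := by positivity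
  have hκA : κ * (A + M + 1) = 1 := by rw [hκdef]; field_simp
  have hκ1 : κ ≤ 1 := by
    rw [hκdef, div_le_one (by positivity)]
    linarith
  set b : ℝ := min 1 (M * (κ / 2) ^ (k + 1) / 4) with hb
  have hb0 : 0 < b := by positivity
  have hb1 : b ≤ 1 := min_le_left _ _
  have hbM : 4 * b ≤ M * (κ / 2) ^ (k + 1) := by
    have : b ≤ M * (κ / 2) ^ (k + 1) / 4 := min_le_right _ _
    linarith
  set D : ℕ := 2 * d + 2 * (k + 1) with hD
  have hD0 : (0 : ℝ) < D := by exact_mod_cast (by omega : 0 < D)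
  set μ : ℝ := 1 / (2 * ((k + 1 : ℕ) : ℝ)) with hμ
  refine ⟨(4 / M) ^ μ * (2 * D / (b * κ)), by positivity, 1, one_pos, le_rfl, ?_⟩
  rintro _ ⟨x, hx, rfl⟩ r hr hr1 δ hδ hδ1 z hz
  set σ : ℝ := (4 / M) ^ μ * δ ^ μ with hσ
  have hσ0 : 0 < σ := by positivity
  have hσpow : M * (σ ^ 2) ^ (k + 1) = 4 * δ := by
    have h1 : σ = (4 / M * δ) ^ μ := by
      rw [hσ, Real.mul_rpow (by positivity) hδ.le]
    rw [← pow_mul, h1, ← Real.rpow_natCast, ← Real.rpow_mul (by positivity), hμ]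
    have h2 : 1 / (2 * ((k + 1 : ℕ) : ℝ)) * ((2 * (k + 1) : ℕ) : ℝ) = 1 := by
      push_cast
      field_simp
    rw [h2, Real.rpow_one]
    field_simp
  have hrn : r ^ (n + 1) ≤ r ^ 2 := pow_le_pow_of_le_one hr.le hr1.le (by omega)
  have hrpos : 0 < r ^ (n + 1) := by positivity
  have hgoal : (4 / M) ^ μ * (2 * D / (b * κ)) * δ ^ μ / r ^ (n + 1) =
      2 * D / (b * κ) * σ / r ^ (n + 1) := by rw [hσ]; ring
  rw [hgoal]
  have hkey : ∀ lam T : ℝ, 0 < lam → 0 < T → lam * (1 + T ^ 2) ≤ κ * r →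
      (∀ t : ℝ, |t| ≤ T → 2 * (δ * (|t| ^ (2 * (k + 1)) + |t| ^ (2 * k + 1))) ≤
        M * (lam * (1 + t ^ 2)) ^ (k + 1)) →
      siciakExt (embRC '' E ∩ closedBall (embRC x) r) z ≤ D / T := by
    intro lam T hlam hT hle hdisp
    have hcx := hc0 x hx
    have := siciakExt_le_of_cusp (r := r) (z := z) hM (c x) (hcusp x hx) (hbound x hx) hlam hT
      (by
        calc lam * (1 + T ^ 2) * (A + M + 1) ≤ κ * r * (A + M + 1) := by gcongr
          _ = r := by rw [mul_right_comm, hκA, one_mul]) hr1.le hdisp (by rwa [hcx])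
    rwa [hcx] at this
  rcases le_or_gt (σ ^ 2) (κ * r / 2) with hcase | hcase
  · obtain ⟨lam, T, hlam, hT, hle, hdisp, hTeq⟩ :=
      exists_cusp_parameters_of_le hκ hκ1 hr hr1 hδ hσ0 hσpow hcase
    refine (hkey lam T hlam hT hle hdisp).trans ?_
    have h1 : (D : ℝ) / T = 2 * D / κ * σ / r := by
      rw [div_eq_mul_one_div, hTeq]
      field_simp
    rw [h1]
    have h2 : r ^ (n + 1) ≤ r := pow_le_of_le_one hr.le hr1.le (by omega)
    have h3 : b * κ ≤ κ := mul_le_of_le_one_left hκ.le hb1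
    gcongr
  · obtain ⟨lam, T, hlam, hT, hle, hdisp, rfl⟩ :=
      exists_cusp_parameters_of_lt (δ := δ) hM hκ hb0 hb1 hbM hr hr1 hδ1
    refine (hkey lam _ hlam hT hle hdisp).trans ?_
    have hσr : κ * r / 2 ≤ σ := by
      refine le_of_sq_le_sq ?_ hσ0.le
      have h2 : κ * r ≤ 1 := mul_le_one₀ hκ1 hr.le hr1.le
      have h3 : 0 < κ * r := by positivity
      nlinarith
    calc (D : ℝ) / (b * r) = 2 * D / (b * κ) * (κ * r / 2) / r ^ 2 := by field_simp
      _ ≤ 2 * D / (b * κ) * σ / r ^ (n + 1) := by gcongr
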